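/- Let γ > 0 and μ ∈ ℝ. Let (a_s)_{s≥1} and (b_s)_{s≥1} be absolutely summable real sequences such that a_1 = γ and a_{s+1} = (1 − γμ)·a_s − γ·Σ_{r=1}^{s−1} b_r a_{s−r} for every s ≥ 1 (the sum being empty for s = 1). Then (μ + Σ_{r=1}^∞ b_r)·(Σ_{s=1}^∞ a_s) = 1. -/

import Mathlib

theorem stmt7 (γ μ : ℝ) (hγ : 0 < γ) (a b : ℕ → ℝ)
    (ha : Summable fun s : ℕ => |a (s + 1)|)
    (hb : Summable fun s : ℕ => |b (s + 1)|)
    (ha1 : a 1 = γ)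
    (hrec : ∀ s : ℕ, 1 ≤ s →
      a (s + 1) = (1 - γ * μ) * a s - γ * ∑ r ∈ Finset.Icc 1 (s - 1), b r * a (s - r)) :
    (μ + ∑' r : ℕ, b (r + 1)) * (∑' s : ℕ, a (s + 1)) = 1 := by
  simp_rw [← Real.norm_eq_abs] at ha hb
  have hconv : HasSum (fun n : ℕ => ∑ k ∈ Finset.range (n + 1), b (k + 1) * a (n - k + 1))
      ((∑' r : ℕ, b (r + 1)) * ∑' s : ℕ, a (s + 1)) := by
    rw [tsum_mul_tsum_eq_tsum_sum_range_of_summable_norm hb ha]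
    exact (summable_norm_sum_mul_range_of_summable_norm hb ha).of_norm.hasSum
  have hA : Summable fun s : ℕ => a (s + 1) := ha.of_norm
  have hrec_conv (n : ℕ) : a (n + 3) = (1 - γ * μ) * a (n + 2) -
      γ * ∑ k ∈ Finset.range (n + 1), b (k + 1) * a (n - k + 1) := by
    rw [hrec (n + 2) (by omega), show n + 2 - 1 = n + 1 by omega,
      ← Finset.Ico_add_one_right_eq_Icc, Finset.sum_Ico_eq_sum_range]
    congr 2
    refine Finset.sum_congr (by simp) fun k hk => ?_
    have hk' : k < n + 1 := Finset.mem_range.mp (by simpa using hk)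
    rw [add_comm 1 k, show n + 2 - (k + 1) = n - k + 1 by omega]
  have ha2 : a 2 = (1 - γ * μ) * γ := by simpa [ha1] using hrec 1 le_rfl
  have hsplit : ∑' s : ℕ, a (s + 1) = γ + ∑' s : ℕ, a (s + 2) := by
    rw [hA.tsum_eq_zero_add, ← ha1]
  have hA' : Summable fun s : ℕ => a (s + 2) := (summable_nat_add_iff 1).mpr hA
  have hsplit' : ∑' s : ℕ, a (s + 2) = (1 - γ * μ) * γ + ∑' s : ℕ, a (s + 3) := by
    rw [hA'.tsum_eq_zero_add, ← ha2]
  have htail : ∑' s : ℕ, a (s + 3) = (1 - γ * μ) * ∑' s : ℕ, a (s + 2) -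
      γ * ((∑' r : ℕ, b (r + 1)) * ∑' s : ℕ, a (s + 1)) := by
    simp_rw [hrec_conv]
    exact ((hA'.hasSum.mul_left _).sub (hconv.mul_left _)).tsum_eq
  apply mul_left_cancel₀ hγ.ne'
  linear_combination hsplit' + htail + γ * μ * hsplit
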